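/- Let K be a field of characteristic zero. There exists a nonzero polynomial G in 44 variables over K such that for every tuple (v_1,…,v_11) of nonzero vectors in K^4 with G(v_1,…,v_11) ≠ 0, the ideal I = ⋂_{j=1}^{11} m_{v_j} of the corresponding simple points in P^3 satisfies: I^{(7)} contains no nonzero homogeneous polynomial of degree 15, and I^{(10)} contains no nonzero homogeneous polynomial of degree 21. Equivalently, α(I^{(7)}) ≥ 16 and α(I^{(10)}) ≥ 22 for 11 points in general position in P^3. -/

import Mathlib

open MvPolynomial Filter

noncomputable section

/-- The ideal of a point of `ℙ³` represented by a nonzero vector `v ∈ K⁴`: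
the ideal generated by all linear forms vanishing at `v`. -/
def pointIdeal (K : Type) [Field K] (v : Fin 4 → K) : Ideal (MvPolynomial (Fin 4) K) :=
  Ideal.span {f | f.IsHomogeneous 1 ∧ eval v f = 0}

/-- `α(J)`: the least `t ≥ 0` such that the degree-`t` homogeneous component of the
homogeneous ideal `J` is nonzero. -/
def alphaDeg {K : Type} [Field K] {σ : Type} (J : Ideal (MvPolynomial σ K)) : ℕ :=
  sInf {t | ∃ f ∈ J, f ≠ 0 ∧ f.IsHomogeneous t}

/-! ### Gaussian elimination on packed rows

A row of residues modulo `p` is stored as one natural number, its base-`B` digits being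
representatives of the entries.  Digits are reduced modulo `p` only when a row becomes a pivot,
so `B` has to exceed the largest digit that can build up.  The functions are written in
continuation-passing style, which makes the kernel evaluate each intermediate number once. -/

/-- Apply `k` to the evaluated form of `n`. -/
def withNat {β : Type} (n : ℕ) (k : ℕ → β) : β :=
  Nat.rec (k 0) (fun n _ => k (Nat.succ n)) n

/-- Multiply the `n` lowest base-`B` digits of a number by `u` and reduce them modulo `p`. -/
def scaleDigits (p B u n : ℕ) : ℕ → ℕ :=
  Nat.rec (fun _ => 0) (fun _ ih r => withNat (Nat.div r B) fun rest =>
    Nat.add (Nat.mod (Nat.mul (Nat.mod r B) u) p) (Nat.mul B (ih rest))) n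

/-- Clear the lowest digit of `r` modulo `p` using the row `q` with lowest digit `1`, and drop
it. -/
def clearDigit (p B q r : ℕ) : ℕ :=
  Nat.div (Nat.add r (Nat.mul (Nat.sub p (Nat.mod (Nat.mod r B) p)) q)) B

/-- Apply `k` to the list of the rows `clearDigit p B q r`, for `r` in `rows`. -/
def clearRows (p B q : ℕ) (rows : List ℕ) : (List ℕ → Bool) → Bool :=
  List.rec (fun k => k []) (fun r _ ih k => withNat (clearDigit p B q r) fun t =>
    ih fun rs => k (t :: rs)) rows

/-- Find a row whose lowest digit is nonzero modulo `p`, normalize it, and apply `k` to it and to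
the list of the other rows. -/
def findPivot (p B n : ℕ) (rows : List ℕ) : (ℕ → List ℕ → Bool) → Bool :=
  List.rec (fun _ => false) (fun r rs ih k =>
    bif Nat.beq (Nat.mod (Nat.mod r B) p) 0 then ih fun q rs' => k q (r :: rs')
    else withNat (scaleDigits p B (Nat.mod (Nat.pow (Nat.mod r B) (Nat.sub p 2)) p) n r) fun q =>
      bif Nat.beq (Nat.mod q B) 1 then k q rs else false) rows

/-- Whether Gaussian elimination finds a pivot in each of the `n` columns. -/
def eliminates (p B n : ℕ) : List ℕ → Bool :=
  Nat.rec (fun _ => true) (fun n ih rows => findPivot p B (Nat.succ n) rows fun q rs =>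
    clearRows p B q rs ih) n

/-- The packed row with entries `ρ a`, for `a` in `L`. -/
def packRow {ι : Type} (p B : ℕ) (ρ : ι → ℕ) (L : List ι) : ℕ :=
  List.rec 0 (fun a _ ih => Nat.add (Nat.mod (ρ a) p) (Nat.mul B ih)) L

/-- Apply `k` to the list of the packed rows `ρ a`, for `a` in `I`. -/
def withRows {ι κ : Type} (p B : ℕ) (ρ : κ → ι → ℕ) (L : List ι) (I : List κ) :
    (List ℕ → Bool) → Bool :=
  List.rec (fun k => k []) (fun a _ ih k => withNat (packRow p B (ρ a) L) fun r =>
    ih fun rs => k (r :: rs)) I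

/-- Apply `k` to the evaluated form of a list. -/
def withTriples (L : List (ℕ × ℕ × ℕ)) : (List (ℕ × ℕ × ℕ) → Bool) → Bool :=
  List.rec (fun k => k []) (fun x _ ih k => withNat x.1 fun a => withNat x.2.1 fun b =>
    withNat x.2.2 fun c => ih fun l => k ((a, b, c) :: l)) L

theorem withNat_eq {β : Type} (n : ℕ) (k : ℕ → β) : withNat n k = k n := by
  cases n <;> rfl

theorem clearRows_eq (p B q : ℕ) (rows : List ℕ) (k : List ℕ → Bool) :
    clearRows p B q rows k = k (rows.map (clearDigit p B q)) := by
  induction rows generalizing k with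
  | nil => rfl
  | cons r rs ih =>
    change withNat _ (fun r' => clearRows p B q rs fun l => k (r' :: l)) = _
    rw [withNat_eq, ih, List.map_cons]

theorem withRows_eq {ι κ : Type} (p B : ℕ) (ρ : κ → ι → ℕ) (L : List ι) (I : List κ)
    (k : List ℕ → Bool) :
    withRows p B ρ L I k = k (I.map fun a => packRow p B (ρ a) L) := by
  induction I generalizing k with
  | nil => rfl
  | cons a l ih =>
    change withNat _ (fun r => withRows p B ρ L l fun rs => k (r :: rs)) = _
    rw [withNat_eq, ih, List.map_cons]

theorem withTriples_eq (L : List (ℕ × ℕ × ℕ)) (k : List (ℕ × ℕ × ℕ) → Bool) :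
    withTriples L k = k L := by
  induction L generalizing k with
  | nil => rfl
  | cons x l ih =>
    change withNat _ (fun a => withNat _ fun b => withNat _ fun c =>
      withTriples l fun l' => k ((a, b, c) :: l')) = _
    rw [withNat_eq, withNat_eq, withNat_eq, ih]

section Soundness

variable {F : Type} [CommRing F]

/-- The pairing of a list of natural numbers with a list of scalars. -/
def listDot (l : List ℕ) (c : List F) : F :=
  (List.zipWith (fun a x => (a : F) * x) l c).sum

/-- `r` packs a row with digits at most `b` that is orthogonal to `c`. -/
def IsRow (B b : ℕ) (c : List F) (r : ℕ) : Prop :=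
  ∃ l : List ℕ, l.length = c.length ∧ (∀ a ∈ l, a ≤ b) ∧ Nat.ofDigits B l = r ∧ listDot l c = 0

theorem listDot_cons (a : ℕ) (l : List ℕ) (x : F) (c : List F) :
    listDot (a :: l) (x :: c) = a * x + listDot l c := by
  simp [listDot]

theorem listDot_eq_zero (l : List ℕ) {c : List F} (hc : ∀ x ∈ c, x = 0) : listDot l c = 0 := by
  induction c generalizing l with
  | nil => simp [listDot]
  | cons x c ih =>
    cases l with
    | nil => simp [listDot]
    | cons a l =>
      rw [listDot_cons, hc x (by simp), ih l fun y hy => hc y (by simp [hy])]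
      simp

theorem listDot_map_mul_mod (p : ℕ) [CharP F p] (u : ℕ) (l : List ℕ) (c : List F) :
    listDot (l.map fun a => a * u % p) c = u * listDot l c := by
  induction l generalizing c with
  | nil => simp [listDot]
  | cons a l ih =>
    cases c with
    | nil => simp [listDot]
    | cons x c =>
      rw [List.map_cons, listDot_cons, listDot_cons, ih, ← CharP.cast_eq_mod F p]
      push_cast
      ring

theorem listDot_zipWith_add_mul (t : ℕ) (l m : List ℕ) (c : List F) (hl : l.length = c.length)
    (hm : m.length = c.length) :
    listDot (List.zipWith (fun a b => a + t * b) l m) c = listDot l c + t * listDot m c := by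
  induction c generalizing l m with
  | nil => simp_all [listDot]
  | cons x c ih =>
    obtain ⟨a, l, rfl⟩ := List.exists_cons_of_length_eq_add_one hl
    obtain ⟨b, m, rfl⟩ := List.exists_cons_of_length_eq_add_one hm
    simp only [List.zipWith_cons_cons, listDot_cons]
    rw [ih l m (by simpa using hl) (by simpa using hm)]
    push_cast
    ring

theorem ofDigits_zipWith_add_mul (B t : ℕ) (l m : List ℕ) (h : l.length = m.length) :
    Nat.ofDigits B (List.zipWith (fun a b => a + t * b) l m) =
      Nat.ofDigits B l + t * Nat.ofDigits B m := by
  induction l generalizing m with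
  | nil => simp_all [List.length_eq_zero_iff.1 h.symm]
  | cons a l ih =>
    obtain ⟨b, m, rfl⟩ := List.exists_cons_of_length_eq_add_one h.symm
    simp only [List.zipWith_cons_cons, Nat.ofDigits_cons]
    rw [ih m (by simpa using h)]
    ring

theorem ofDigits_cons_mod {B a : ℕ} (l : List ℕ) (ha : a < B) :
    Nat.ofDigits B (a :: l) % B = a := by
  rw [Nat.ofDigits_cons, Nat.add_mul_mod_self_left, Nat.mod_eq_of_lt ha]

theorem ofDigits_cons_div {B a : ℕ} (l : List ℕ) (ha : a < B) :
    Nat.ofDigits B (a :: l) / B = Nat.ofDigits B l := by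
  rw [Nat.ofDigits_cons, Nat.add_mul_div_left _ _ (by omega), Nat.div_eq_of_lt ha,
    zero_add]

theorem scaleDigits_succ (p B u n r : ℕ) :
    scaleDigits p B u (n + 1) r = r % B * u % p + B * scaleDigits p B u n (r / B) := by
  change withNat _ (fun r' => r % B * u % p + B * scaleDigits p B u n r') = _
  rw [withNat_eq]
  rfl

theorem scaleDigits_ofDigits (p B u : ℕ) (l : List ℕ) (hl : ∀ a ∈ l, a < B) :
    scaleDigits p B u l.length (Nat.ofDigits B l) =
      Nat.ofDigits B (l.map fun a => a * u % p) := by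
  induction l with
  | nil => rfl
  | cons a l ih =>
    rw [List.length_cons, scaleDigits_succ, ofDigits_cons_mod l (hl a (by simp)),
      ofDigits_cons_div l (hl a (by simp)), ih fun x hx => hl x (by simp [hx]), List.map_cons,
      Nat.ofDigits_cons]

theorem IsRow.scaleDigits {p B b : ℕ} [CharP F p] (hp : 0 < p) (hb : b < B) {c : List F} {r : ℕ}
    (h : IsRow B b c r) (u : ℕ) : IsRow B p c (scaleDigits p B u c.length r) := by
  obtain ⟨l, hl, hlb, rfl, h0⟩ := h
  refine ⟨l.map fun a => a * u % p, by simpa using hl, ?_, ?_, ?_⟩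
  · simp only [List.mem_map]
    rintro _ ⟨a, -, rfl⟩
    exact (Nat.mod_lt _ hp).le
  · rw [← hl, scaleDigits_ofDigits p B u l fun a ha => (hlb a ha).trans_lt hb]
  · rw [listDot_map_mul_mod, h0, mul_zero]

theorem IsRow.clearDigit {p B b : ℕ} [CharP F p] (hp : 0 < p) (hb : b + p * p < B) {x : F}
    {c : List F} {q r : ℕ} (hq : IsRow B p (x :: c) q) (hq1 : q % B = 1)
    (h : IsRow B b (x :: c) r) : IsRow B (b + p * p) c (clearDigit p B q r) := by
  obtain ⟨l, hl, hlb, rfl, h0⟩ := h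
  obtain ⟨m, hm, hmb, rfl, h0'⟩ := hq
  obtain ⟨a, l, rfl⟩ := List.exists_cons_of_length_eq_add_one hl
  obtain ⟨y, m, rfl⟩ := List.exists_cons_of_length_eq_add_one hm
  have hlm : (a :: l).length = (y :: m).length := hl.trans hm.symm
  have hpp : p ≤ p * p := Nat.le_mul_self p
  have ha : a ≤ b := hlb a (by simp)
  have hy : y ≤ p := hmb y (by simp)
  have hl' : l.length = c.length := by simpa using hl
  have hm' : m.length = c.length := by simpa using hm
  rw [ofDigits_cons_mod m (by omega)] at hq1
  subst hq1
  have htp : p - a % p ≤ p := Nat.sub_le _ _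
  refine ⟨List.zipWith (fun u v => u + (p - a % p) * v) l m, by simp [hl', hm'], ?_, ?_, ?_⟩
  · intro z hz
    rw [List.mem_iff_getElem] at hz
    obtain ⟨i, hi, rfl⟩ := hz
    rw [List.getElem_zipWith]
    exact Nat.add_le_add (hlb _ (by simp)) (Nat.mul_le_mul htp (hmb _ (by simp)))
  · change _ = (_ + (p - Nat.ofDigits B (a :: l) % B % p) * _) / B
    rw [ofDigits_cons_mod l (by omega), ← ofDigits_zipWith_add_mul _ _ _ _ hlm,
      List.zipWith_cons_cons, mul_one, ofDigits_cons_div _ (by omega)]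
  · rw [listDot_zipWith_add_mul _ _ _ _ hl' hm']
    rw [listDot_cons] at h0 h0'
    have hcast : (a : F) + ((p - a % p : ℕ) : F) = 0 := by
      rw [Nat.cast_sub (Nat.mod_lt _ hp).le, CharP.cast_eq_zero F p, ← CharP.cast_eq_mod F p]
      ring
    push_cast at h0'
    linear_combination h0 + ((p - a % p : ℕ) : F) * h0' - x * hcast

theorem exists_of_findPivot {p B b : ℕ} [CharP F p] (hp : 0 < p) (hb : b < B) {c : List F}
    {rows : List ℕ} {k : ℕ → List ℕ → Bool} (h : findPivot p B c.length rows k = true)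
    (hrows : ∀ r ∈ rows, IsRow B b c r) :
    ∃ q rs, k q rs = true ∧ IsRow B p c q ∧ q % B = 1 ∧ ∀ r ∈ rs, IsRow B b c r := by
  induction rows generalizing k with
  | nil => exact absurd h (by simp [findPivot])
  | cons r rs ih =>
    change (bif Nat.beq (r % B % p) 0 then findPivot p B c.length rs fun q rs' => k q (r :: rs')
      else withNat (scaleDigits p B _ c.length r) _) = true at h
    cases hr : Nat.beq (r % B % p) 0 with
    | true =>
      rw [hr, cond_true] at h
      obtain ⟨q, rs', hk, hq, hq1, hrs'⟩ := ih h fun r' hr' => hrows r' (by simp [hr'])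
      refine ⟨q, r :: rs', hk, hq, hq1, ?_⟩
      simpa using ⟨hrows r (by simp), hrs'⟩
    | false =>
      rw [hr, cond_false, withNat_eq] at h
      generalize hu : Nat.mod (Nat.pow (Nat.mod r B) (Nat.sub p 2)) p = u at h
      cases hq : Nat.beq (Nat.mod (scaleDigits p B u c.length r) B) 1 with
      | true =>
        rw [hq, cond_true] at h
        exact ⟨_, rs, h, (hrows r (by simp)).scaleDigits hp hb u, Nat.eq_of_beq_eq_true hq,
          fun r' hr' => hrows r' (by simp [hr'])⟩
      | false => simp [hq] at h

theorem eq_zero_of_eliminates {p B b : ℕ} [CharP F p] (hp : 0 < p) {c : List F}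
    {rows : List ℕ} (h : eliminates p B c.length rows = true)
    (hrows : ∀ r ∈ rows, IsRow B b c r) (hb : b + c.length * (p * p) < B) : ∀ x ∈ c, x = 0 := by
  induction c generalizing b rows with
  | nil => simp
  | cons x c ih =>
    rw [List.length_cons, add_one_mul] at hb
    change findPivot p B (x :: c).length rows (fun q rs =>
      clearRows p B q rs (eliminates p B c.length)) = true at h
    obtain ⟨q, rs, hk, hq, hq1, hrs⟩ := exists_of_findPivot hp (by omega) h hrows
    rw [clearRows_eq] at hk
    have hc : ∀ y ∈ c, y = 0 := by
      refine ih (b := b + p * p) hk ?_ (by omega)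
      simp only [List.mem_map]
      rintro _ ⟨r, hr, rfl⟩
      exact hq.clearDigit hp (by omega) hq1 (hrs r hr)
    obtain ⟨l, hl, hlb, rfl, h0⟩ := hq
    obtain ⟨a, l, rfl⟩ := List.exists_cons_of_length_eq_add_one hl
    have hpp : p ≤ p * p := Nat.le_mul_self p
    rw [ofDigits_cons_mod l ((hlb a (by simp)).trans_lt (by omega))] at hq1
    rw [listDot_cons, listDot_eq_zero l hc, hq1] at h0
    simpa [show x = 0 by simpa using h0] using hc

theorem isRow_packRow {ι : Type} {p : ℕ} [CharP F p] (hp : 0 < p) (B : ℕ) {ρ : ι → ℕ} {c : ι → F}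
    {L : List ι} (h : (L.map fun a => (ρ a : F) * c a).sum = 0) :
    IsRow B p (L.map c) (packRow p B ρ L) := by
  refine ⟨L.map fun a => ρ a % p, by simp, ?_, ?_, ?_⟩
  · simp only [List.mem_map]
    rintro _ ⟨a, -, rfl⟩
    exact (Nat.mod_lt _ hp).le
  · clear h
    induction L with
    | nil => rfl
    | cons a l ih =>
      rw [List.map_cons, Nat.ofDigits_cons, ih]
      rfl
  · rw [← h]
    clear h
    induction L with
    | nil => simp [listDot]
    | cons a l ih =>
      rw [List.map_cons, List.map_cons, listDot_cons, ih, ← CharP.cast_eq_mod F p]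
      simp

end Soundness

/-! ### The eleven points -/

/-- The triples `(α₀, α₂, α₃)` of the exponent vectors `α` of degree `d` with `αᵢ ≤ d - m` for
`i ≠ 0` and weight `α₁ + 2α₂ + 3α₃ ≡ r` modulo `4`. -/
def expList (d m r : ℕ) : List (ℕ × ℕ × ℕ) :=
  (List.range (d + 1) ×ˢ List.range (d - m + 1) ×ˢ List.range (d - m + 1)).filter fun x =>
    Nat.ble (x.1 + x.2.1 + x.2.2) d && Nat.ble (d - (x.1 + x.2.1 + x.2.2)) (d - m) &&
      Nat.beq ((d - (x.1 + x.2.1 + x.2.2) + 2 * x.2.1 + 3 * x.2.2) % 4) r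

/-- The triples of natural numbers with sum less than `m`. -/
def orderList (m : ℕ) : List (ℕ × ℕ × ℕ) :=
  (List.range m ×ˢ List.range m ×ˢ List.range m).filter fun x =>
    Nat.ble (x.1 + x.2.1 + x.2.2 + 1) m

/-- Coefficients of the vanishing conditions at the point `(0, 1, 1, 2)`. -/
def planeEntry (b x : ℕ × ℕ × ℕ) : ℕ :=
  bif Nat.beq x.1 b.1 then
    Nat.mul (Nat.pow x.2.1 b.2.1) (Nat.mul (Nat.pow x.2.2 b.2.2) (Nat.pow 2 x.2.2))
  else 0

/-- Coefficients of the vanishing conditions at the point `(1, 1, 1, 1)`. -/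
def spaceEntry (b x : ℕ × ℕ × ℕ) : ℕ :=
  Nat.mul (Nat.pow x.1 b.1) (Nat.mul (Nat.pow x.2.1 b.2.1) (Nat.pow x.2.2 b.2.2))

/-- Whether elimination modulo `13` shows that the vanishing conditions of order `m` at both points
have full rank on the exponents in `expList d m r`. -/
def hasFullRank (d m r : ℕ) : Bool :=
  withTriples (expList d m r) fun L => withTriples (orderList m) fun I =>
    withRows 13 65536 planeEntry L I fun P => withRows 13 65536 spaceEntry L I fun Q =>
      withNat L.length fun n =>
        Nat.ble (Nat.add 14 (Nat.mul n 169)) 65536 && eliminates 13 65536 n (P ++ Q)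

theorem eq_zero_of_hasFullRank {d m r : ℕ} (h : hasFullRank d m r = true)
    {c : ℕ × ℕ × ℕ → ZMod 13}
    (hP : ∀ b ∈ orderList m,
      ((expList d m r).map fun x => (planeEntry b x : ZMod 13) * c x).sum = 0)
    (hQ : ∀ b ∈ orderList m,
      ((expList d m r).map fun x => (spaceEntry b x : ZMod 13) * c x).sum = 0) :
    ∀ x ∈ expList d m r, c x = 0 := by
  simp only [hasFullRank, withTriples_eq, withRows_eq, withNat_eq, Bool.and_eq_true] at h
  have hn := Nat.le_of_ble_eq_true h.1
  change 14 + _ * 169 ≤ 65536 at hn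
  have := eq_zero_of_eliminates (F := ZMod 13) (p := 13) (B := 65536) (b := 13)
    (c := (expList d m r).map c) (by norm_num) (by rw [List.length_map]; exact h.2) ?_
    (by rw [List.length_map]; omega)
  · intro x hx
    exact this _ (List.mem_map_of_mem hx)
  · intro R hR
    rw [List.mem_append, List.mem_map, List.mem_map] at hR
    rcases hR with ⟨b, hb, rfl⟩ | ⟨b, hb, rfl⟩
    · exact isRow_packRow (by norm_num) _ (hP b hb)
    · exact isRow_packRow (by norm_num) _ (hQ b hb)

theorem hasFullRank_fifteen_zero : hasFullRank 15 7 0 = true := by decide +kernel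

theorem hasFullRank_fifteen_one : hasFullRank 15 7 1 = true := by decide +kernel

theorem hasFullRank_fifteen_two : hasFullRank 15 7 2 = true := by decide +kernel

theorem hasFullRank_fifteen_three : hasFullRank 15 7 3 = true := by decide +kernel

theorem hasFullRank_twentyOne_zero : hasFullRank 21 10 0 = true := by decide +kernel

theorem hasFullRank_twentyOne_one : hasFullRank 21 10 1 = true := by decide +kernel

theorem hasFullRank_twentyOne_two : hasFullRank 21 10 2 = true := by decide +kernel

theorem hasFullRank_twentyOne_three : hasFullRank 21 10 3 = true := by decide +kernel

/-! ### Vanishing conditions -/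

/-- The value at `v` of the monomial with exponent `α`, after applying `(xᵢ ∂ᵢ) ^ bᵢ` and then
`∂ᵢ ^ γᵢ` for each `i`. -/
def monomialJet {A : Type} [CommRing A] (v : Fin 4 → A) (γ b α : Fin 4 → ℕ) : A :=
  ∏ i, ((α i ^ b i * (α i).descFactorial (γ i) : ℕ) : A) * v i ^ (α i - γ i)

theorem map_monomialJet {A B : Type} [CommRing A] [CommRing B] (φ : A →+* B) (v : Fin 4 → A)
    (γ b α : Fin 4 → ℕ) : φ (monomialJet v γ b α) = monomialJet (fun i => φ (v i)) γ b α := by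
  simp [monomialJet]

section Derivation

variable {R A : Type} [CommRing R] [CommRing A] [Algebra R A]

theorem derivation_mem_pow (D : Derivation R A A) {I : Ideal A} {k : ℕ} {f : A}
    (hf : f ∈ I ^ (k + 1)) : D f ∈ I ^ k := by
  induction k generalizing f with
  | zero => simp
  | succ k ih =>
    rw [pow_succ] at hf
    induction hf using Submodule.mul_induction_on' with
    | mem_mul_mem a ha b hb =>
      rw [D.leibniz, smul_eq_mul, smul_eq_mul]
      exact add_mem (Ideal.mul_mem_right _ _ ha)
        (by rw [pow_succ, mul_comm b]; exact Ideal.mul_mem_mul (ih ha) hb)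
    | add a _ b _ ha hb => rw [map_add]; exact add_mem ha hb

theorem derivation_iterate_mem_pow (D : Derivation R A A) {I : Ideal A} {k n : ℕ} {f : A}
    (hf : f ∈ I ^ (k + n)) : D^[n] f ∈ I ^ k := by
  induction n generalizing f with
  | zero => exact hf
  | succ n ih => exact ih (derivation_mem_pow D hf)

end Derivation

section Jet

variable {K : Type} [Field K]

/-- The differential operator `∂ᵢ ^ c (xᵢ ∂ᵢ) ^ b`. -/
def jetOp (i : Fin 4) (c b : ℕ) : MvPolynomial (Fin 4) K →ₗ[K] MvPolynomial (Fin 4) K :=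
  (pderiv i : Derivation K (MvPolynomial (Fin 4) K) _).toLinearMap ^ c *
    ((X i : MvPolynomial (Fin 4) K) • pderiv i :
      Derivation K (MvPolynomial (Fin 4) K) (MvPolynomial (Fin 4) K)).toLinearMap ^ b

theorem jetOp_mem_pow {I : Ideal (MvPolynomial (Fin 4) K)} {k : ℕ} (i : Fin 4) (c b : ℕ)
    {f : MvPolynomial (Fin 4) K} (hf : f ∈ I ^ (k + (c + b))) : jetOp i c b f ∈ I ^ k := by
  rw [← add_assoc] at hf
  rw [jetOp, Module.End.mul_apply, Module.End.pow_apply, Module.End.pow_apply]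
  exact derivation_iterate_mem_pow _ (derivation_iterate_mem_pow _ hf)

theorem jetOp_monomial (i : Fin 4) (c b : ℕ) (α : Fin 4 →₀ ℕ) (a : K) :
    jetOp i c b (monomial α a) =
      monomial (α - Finsupp.single i c) (a * ((α i ^ b * (α i).descFactorial c : ℕ) : K)) := by
  have hb : ∀ a : K, (((X i : MvPolynomial (Fin 4) K) • pderiv i :
      Derivation K (MvPolynomial (Fin 4) K) (MvPolynomial (Fin 4) K)).toLinearMap ^ b)
        (monomial α a) = monomial α (a * (α i : K) ^ b) := by
    induction b with
    | zero => simp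
    | succ b ih =>
      intro a
      rw [pow_succ, Module.End.mul_apply]
      have : ((X i : MvPolynomial (Fin 4) K) • pderiv i :
          Derivation K (MvPolynomial (Fin 4) K) (MvPolynomial (Fin 4) K)).toLinearMap
            (monomial α a) = monomial α (a * α i) := by
        change X i * pderiv i (monomial α a) = _
        rw [X_mul_pderiv_monomial, ← map_nsmul, nsmul_eq_mul, mul_comm]
      rw [this, ih, mul_assoc, ← pow_succ']
  rw [jetOp, Module.End.mul_apply, hb]
  push_cast
  rw [← mul_assoc]
  generalize a * (α i : K) ^ b = a
  induction c with
  | zero => simp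
  | succ c ih =>
    rw [pow_succ', Module.End.mul_apply, ih]
    simp [pderiv_monomial, tsub_tsub, ← Finsupp.single_add, Nat.descFactorial_succ, mul_comm,
      mul_left_comm]

theorem pointIdeal_le_ker (v : Fin 4 → K) : pointIdeal K v ≤ RingHom.ker (eval v) :=
  Ideal.span_le.2 fun _ hf => hf.2

theorem sum_coeff_mul_monomialJet {v : Fin 4 → K} {m d : ℕ} {f : MvPolynomial (Fin 4) K}
    (hf : f ∈ pointIdeal K v ^ m) (hd : f.IsHomogeneous d) {γ b : Fin 4 → ℕ}
    (h : ∑ i, γ i + ∑ i, b i < m) :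
    ∑ α ∈ Finset.univ.finsuppAntidiag d, f.coeff α * monomialJet v γ b α = 0 := by
  set O : MvPolynomial (Fin 4) K →ₗ[K] MvPolynomial (Fin 4) K :=
    jetOp 0 (γ 0) (b 0) * (jetOp 1 (γ 1) (b 1) * (jetOp 2 (γ 2) (b 2) * jetOp 3 (γ 3) (b 3)))
  have hO : ∀ (α : Fin 4 →₀ ℕ) (a : K), eval v (O (monomial α a)) = a * monomialJet v γ b α := by
    intro α a
    simp only [O, Module.End.mul_apply, jetOp_monomial, eval_monomial, monomialJet,
      Finsupp.prod_fintype, pow_zero, implies_true, Fin.prod_univ_four, Finsupp.tsub_apply]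
    simp
    ring
  have hmem : O f ∈ pointIdeal K v ^ 1 := by
    refine jetOp_mem_pow _ _ _ (jetOp_mem_pow _ _ _ (jetOp_mem_pow _ _ _ (jetOp_mem_pow _ _ _
      (Ideal.pow_le_pow_right ?_ hf))))
    rw [Fin.sum_univ_four, Fin.sum_univ_four] at h
    omega
  rw [pow_one] at hmem
  have h0 : eval v (O f) = 0 := pointIdeal_le_ker v hmem
  have hsupp : f.support ⊆ Finset.univ.finsuppAntidiag d := fun α hα => by
    rw [Finset.mem_finsuppAntidiag]
    refine ⟨?_, Finset.subset_univ _⟩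
    rw [← Finsupp.degree_eq_sum]
    exact not_not.1 fun hne => mem_support_iff.1 hα (hd.coeff_eq_zero hne)
  rw [← h0]
  conv_rhs => rw [f.as_sum, map_sum, map_sum]
  simp only [hO]
  exact (Finset.sum_subset hsupp fun α _ hα => by rw [notMem_support_iff.1 hα, zero_mul]).symm

end Jet

/-! ### Semicontinuity of the rank -/

/-- If an integral polynomial matrix becomes injective over a prime field after some
specialization, then it is injective after every specialization outside a hypersurface. -/
theorem exists_forall_mulVec_eq_zero {S T τ : Type} [Fintype S] [Fintype T] [DecidableEq S]
    [DecidableEq T] (p : ℕ) [Fact p.Prime] (M : Matrix S T (MvPolynomial τ ℤ)) (w : τ → ZMod p)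
    (hw : ∀ c, (M.map (eval₂Hom (Int.castRingHom _) w)).mulVec c = 0 → c = 0) :
    ∃ G : MvPolynomial τ ℤ, G ≠ 0 ∧ ∀ (K : Type) [Field K] (v : τ → K),
      eval₂Hom (Int.castRingHom K) v G ≠ 0 →
        ∀ c, (M.map (eval₂Hom (Int.castRingHom K) v)).mulVec c = 0 → c = 0 := by
  obtain ⟨g, hg⟩ := LinearMap.exists_leftInverse_of_injective
    (Matrix.toLin' (M.map (eval₂Hom (Int.castRingHom _) w)))
    (LinearMap.ker_eq_bot'.2 fun c hc => hw c (by simpa using hc))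
  let N : Matrix T S ℤ := fun t s => (LinearMap.toMatrix' g t s).val
  let N' : Matrix T S (MvPolynomial τ ℤ) := N.map C
  have hN : N.map (Int.castRingHom (ZMod p)) = LinearMap.toMatrix' g := by
    ext t s
    rw [Matrix.map_apply]
    simp [N]
  have key : ∀ (K : Type) [Field K] (v : τ → K),
      eval₂Hom (Int.castRingHom K) v (N' * M).det =
        (N.map (Int.castRingHom K) * M.map (eval₂Hom (Int.castRingHom K) v)).det := by
    intro K _ v
    rw [RingHom.map_det, RingHom.mapMatrix_apply, Matrix.map_mul]
    congr 2
    ext t s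
    change eval₂Hom (Int.castRingHom K) v (C (N t s)) = Int.castRingHom K (N t s)
    simp
  refine ⟨(N' * M).det, ?_, ?_⟩
  · intro h0
    have := key (ZMod p) w
    rw [h0, map_zero, hN, ← LinearMap.toMatrix'_toLin' (M.map _), ← LinearMap.toMatrix'_comp, hg,
      LinearMap.toMatrix'_id, Matrix.det_one] at this
    exact zero_ne_one this
  · intro K _ v hv c hc
    rw [key] at hv
    refine Matrix.eq_zero_of_mulVec_eq_zero hv ?_
    rw [← Matrix.mulVec_mulVec, hc, Matrix.mulVec_zero]

/-- If the vanishing conditions of order `m` at eleven points over a prime field are independent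
on the forms of degree `d`, then no form of degree `d` vanishes to order `m` at eleven points
outside a hypersurface. -/
theorem exists_forall_mem_iInf_pow_eq_zero (p : ℕ) [Fact p.Prime] (d m : ℕ)
    (w : Fin 11 → Fin 4 → ZMod p)
    (hw : ∀ c : (Fin 4 →₀ ℕ) → ZMod p,
      (∀ j (γ b : Fin 4 → ℕ), ∑ i, γ i + ∑ i, b i < m →
        ∑ α ∈ Finset.univ.finsuppAntidiag d, c α * monomialJet (w j) γ b α = 0) →
      ∀ α ∈ Finset.univ.finsuppAntidiag d, c α = 0) :
    ∃ G : MvPolynomial (Fin 11 × Fin 4) ℤ, G ≠ 0 ∧ ∀ (K : Type) [Field K] (v : Fin 11 → Fin 4 → K),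
      eval₂Hom (Int.castRingHom K) (fun q => v q.1 q.2) G ≠ 0 →
        ∀ f ∈ ⨅ j, pointIdeal K (v j) ^ m, f.IsHomogeneous d → f = 0 := by
  let M : Matrix (Fin 11 × (Fin 4 → Fin m) × (Fin 4 → Fin m))
      (Finset.univ.finsuppAntidiag d : Finset (Fin 4 →₀ ℕ)) (MvPolynomial (Fin 11 × Fin 4) ℤ) :=
    fun i α => if ∑ k, (i.2.1 k : ℕ) + ∑ k, (i.2.2 k : ℕ) < m then
      monomialJet (fun k => X (i.1, k)) (fun k => i.2.1 k) (fun k => i.2.2 k) α.1 else 0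
  have hM : ∀ (K : Type) [Field K] (v : Fin 11 → Fin 4 → K) (c : (Fin 4 →₀ ℕ) → K)
      (i : Fin 11 × (Fin 4 → Fin m) × (Fin 4 → Fin m)),
      (M.map (eval₂Hom (Int.castRingHom K) fun q => v q.1 q.2)).mulVec (fun α => c α.1) i =
        if ∑ k, (i.2.1 k : ℕ) + ∑ k, (i.2.2 k : ℕ) < m then
          ∑ α ∈ Finset.univ.finsuppAntidiag d,
            c α * monomialJet (v i.1) (fun k => i.2.1 k) (fun k => i.2.2 k) α else 0 := by
    intro K _ v c i
    rw [Matrix.mulVec, dotProduct]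
    by_cases h : ∑ k, (i.2.1 k : ℕ) + ∑ k, (i.2.2 k : ℕ) < m
    · rw [if_pos h, ← Finset.sum_coe_sort (Finset.univ.finsuppAntidiag d)]
      refine Finset.sum_congr rfl fun α _ => ?_
      rw [Matrix.map_apply, mul_comm]
      simp only [M, if_pos h, map_monomialJet]
      simp
    · rw [if_neg h]
      refine Finset.sum_eq_zero fun α _ => ?_
      rw [Matrix.map_apply]
      simp only [M, if_neg h, map_zero, zero_mul]
  obtain ⟨G, hG, hGv⟩ := exists_forall_mulVec_eq_zero p M (fun q => w q.1 q.2) (by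
    intro c' hc
    obtain ⟨c, rfl⟩ : ∃ c : (Fin 4 →₀ ℕ) → ZMod p, c' = fun α => c α.1 :=
      ⟨Function.extend Subtype.val c' 0,
        funext fun α => (Subtype.val_injective.extend_apply c' 0 α).symm⟩
    ext α
    refine hw c (fun j γ b h => ?_) α.1 α.2
    have hγ : ∀ k, γ k < m := fun k =>
      (Finset.single_le_sum (fun _ _ => Nat.zero_le _) (Finset.mem_univ k)).trans_lt
        ((Nat.le_add_right _ _).trans_lt h)
    have hb : ∀ k, b k < m := fun k =>
      (Finset.single_le_sum (fun _ _ => Nat.zero_le _) (Finset.mem_univ k)).trans_lt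
        ((Nat.le_add_left _ _).trans_lt h)
    have := hM (ZMod p) w c (j, fun k => ⟨γ k, hγ k⟩, fun k => ⟨b k, hb k⟩)
    rw [hc, if_pos h] at this
    exact this.symm)
  refine ⟨G, hG, fun K _ v hv f hf hd => ?_⟩
  have h0 := hGv K _ hv (fun α => f.coeff α.1) (by
    ext i
    rw [hM K v (fun α => f.coeff α)]
    split_ifs with h
    · exact sum_coeff_mul_monomialJet ((Ideal.mem_iInf.1 hf) i.1) hd h
    · rfl)
  ext α
  rw [coeff_zero]
  by_cases hα : α ∈ Finset.univ.finsuppAntidiag d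
  · exact congrFun h0 ⟨α, hα⟩
  · refine hd.coeff_eq_zero fun h => hα ?_
    rw [Finset.mem_finsuppAntidiag, ← Finsupp.degree_eq_sum]
    exact ⟨h, Finset.subset_univ _⟩

/-! ### The special configuration -/

/-- The weight of an exponent vector for the diagonal action of the fourth roots of unity. -/
def expWeight (α : Fin 4 →₀ ℕ) : ℕ :=
  α 1 + 2 * α 2 + 3 * α 3

/-- The image of `v` under the `g`-th power of the diagonal action; `5` is a primitive fourth root
of unity modulo `13`. -/
def rotate (v : Fin 4 → ZMod 13) (g : ℕ) (i : Fin 4) : ZMod 13 :=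
  5 ^ (g * i) * v i

/-- Three coordinate points and two orbits of length four. -/
def specialPoints : Fin 11 → Fin 4 → ZMod 13 :=
  ![Pi.single 1 1, Pi.single 2 1, Pi.single 3 1,
    rotate ![0, 1, 1, 2] 0, rotate ![0, 1, 1, 2] 1, rotate ![0, 1, 1, 2] 2, rotate ![0, 1, 1, 2] 3,
    rotate ![1, 1, 1, 1] 0, rotate ![1, 1, 1, 1] 1, rotate ![1, 1, 1, 1] 2, rotate ![1, 1, 1, 1] 3]

theorem monomialJet_rotate (v : Fin 4 → ZMod 13) (g k : ℕ) (b : Fin 4 → ℕ) (α : Fin 4 →₀ ℕ) :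
    monomialJet (rotate v g) ![k, 0, 0, 0] b α =
      monomialJet v ![k, 0, 0, 0] b α * 5 ^ (g * expWeight α) := by
  simp only [monomialJet, rotate, expWeight, Fin.prod_univ_four, mul_pow, ← pow_mul]
  simp
  ring

theorem sum_filter_expWeight_eq_zero {s : Finset (Fin 4 →₀ ℕ)} {T : (Fin 4 →₀ ℕ) → ZMod 13}
    (h : ∀ g < 4, ∑ α ∈ s, T α * 5 ^ (g * expWeight α) = 0) {r : ℕ} (hr : r < 4) :
    ∑ α ∈ s with expWeight α % 4 = r, T α = 0 := by
  have horth : ∀ k < 4, ∀ r < 4, ∑ g ∈ Finset.range 4, ((8 : ZMod 13) ^ (g * r) * (5 ^ k) ^ g) =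
      if k = r then 4 else 0 := by decide
  have key : ∑ g ∈ Finset.range 4,
      (8 : ZMod 13) ^ (g * r) * ∑ α ∈ s, T α * 5 ^ (g * expWeight α) = 0 :=
    Finset.sum_eq_zero fun g hg => by rw [h g (Finset.mem_range.1 hg), mul_zero]
  simp_rw [Finset.mul_sum] at key
  rw [Finset.sum_comm] at key
  have h5 : ∀ n : ℕ, (5 : ZMod 13) ^ n = 5 ^ (n % 4) := fun n =>
    pow_eq_pow_mod n (by decide)
  have hα : ∀ α ∈ s, ∑ g ∈ Finset.range 4, (8 : ZMod 13) ^ (g * r) * (T α * 5 ^ (g * expWeight α)) =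
      4 * if expWeight α % 4 = r then T α else 0 := by
    intro α _
    have hsum : ∑ g ∈ Finset.range 4, (8 : ZMod 13) ^ (g * r) * (T α * 5 ^ (g * expWeight α)) =
        T α * ∑ g ∈ Finset.range 4, (8 : ZMod 13) ^ (g * r) * (5 ^ expWeight α) ^ g := by
      rw [Finset.mul_sum]
      refine Finset.sum_congr rfl fun g _ => ?_
      rw [← pow_mul, mul_comm (expWeight α)]
      ring
    rw [hsum, h5, horth _ (Nat.mod_lt _ (by norm_num)) r hr]
    split_ifs <;> ring
  rw [Finset.sum_congr rfl hα, ← Finset.mul_sum, ← Finset.sum_filter] at key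
  have h4 : ∀ x : ZMod 13, 4 * x = 0 → x = 0 := by decide
  exact h4 _ key

instance fact_prime_thirteen : Fact (Nat.Prime 13) :=
  ⟨by norm_num⟩

theorem cast_factorial_ne_zero {k : ℕ} (hk : k < 13) : (k.factorial : ZMod 13) ≠ 0 := by
  rw [Ne, ZMod.natCast_eq_zero_iff, (by norm_num : Nat.Prime 13).dvd_factorial]
  omega

theorem monomialJet_plane {k : ℕ} (y z : ℕ) (α : Fin 4 →₀ ℕ) :
    monomialJet ![0, 1, 1, 2] ![k, 0, 0, 0] ![0, 0, y, z] α =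
      (k.factorial : ZMod 13) * planeEntry (k, y, z) (α 0, α 2, α 3) := by
  have h : (((α 0).descFactorial k : ℕ) : ZMod 13) * 0 ^ (α 0 - k) =
      if α 0 = k then (k.factorial : ZMod 13) else 0 := by
    rcases lt_trichotomy (α 0) k with h | h | h
    · simp [Nat.descFactorial_of_lt h, h.ne]
    · simp [h, Nat.descFactorial_self]
    · simp [h.ne', (Nat.sub_pos_of_lt h).ne']
  have hbeq : Nat.beq (α 0) k = decide (α 0 = k) := by rw [Bool.eq_iff_iff]; simp
  simp only [monomialJet, Fin.prod_univ_four, planeEntry, hbeq]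
  simp [h]
  split_ifs <;> simp_all [mul_assoc]

theorem monomialJet_space (x y z : ℕ) (α : Fin 4 →₀ ℕ) :
    monomialJet ![1, 1, 1, 1] ![0, 0, 0, 0] ![x, 0, y, z] α =
      (spaceEntry (x, y, z) (α 0, α 2, α 3) : ZMod 13) := by
  simp only [monomialJet, Fin.prod_univ_four, spaceEntry]
  simp
  ring

theorem eq_zero_of_coordinate {d m : ℕ} (hm : m ≤ 13) {c : (Fin 4 →₀ ℕ) → ZMod 13} {i : Fin 4}
    (h : ∀ γ b : Fin 4 → ℕ, ∑ i, γ i + ∑ i, b i < m →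
      ∑ α ∈ Finset.univ.finsuppAntidiag d, c α * monomialJet (Pi.single i 1) γ b α = 0)
    {α : Fin 4 →₀ ℕ} (hα : α ∈ Finset.univ.finsuppAntidiag d) (hi : d < α i + m) : c α = 0 := by
  have hsum : ∀ β ∈ Finset.univ.finsuppAntidiag d, ∑ j ∈ Finset.univ.erase i, β j + β i = d := by
    intro β hβ
    rw [Finset.sum_erase_add _ _ (Finset.mem_univ i)]
    exact (Finset.mem_finsuppAntidiag.1 hβ).1
  have hlt : ∑ j ∈ Finset.univ.erase i, α j < m := by
    have := hsum α hα
    omega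
  set γ : Fin 4 → ℕ := Function.update α i 0 with hγ
  have hγj : ∀ j, j ≠ i → γ j = α j := fun j hj => Function.update_of_ne hj _ _
  have hγi : γ i = 0 := Function.update_self _ _ _
  have hγsum : ∑ j, γ j = ∑ j ∈ Finset.univ.erase i, α j := by
    rw [← Finset.sum_erase_add _ _ (Finset.mem_univ i), hγi, add_zero]
    exact Finset.sum_congr rfl fun j hj => hγj j (Finset.ne_of_mem_erase hj)
  have h0 := h γ 0 (by simpa [hγsum] using hlt)
  rw [Finset.sum_eq_single_of_mem α hα] at h0
  · refine (mul_eq_zero.1 h0).resolve_right ?_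
    refine Finset.prod_ne_zero_iff.2 ?_
    intro j _
    by_cases hj : j = i
    · subst hj
      simp [hγi]
    · have hjm : α j < 13 := ((Finset.single_le_sum (fun _ _ => Nat.zero_le _)
        (Finset.mem_erase.2 ⟨hj, Finset.mem_univ j⟩)).trans_lt hlt).trans_le hm
      simpa [hγj j hj, Nat.descFactorial_self] using cast_factorial_ne_zero hjm
  · intro β hβ hne
    have : ∃ j, j ≠ i ∧ β j ≠ α j := by
      by_contra! hall
      refine hne (Finsupp.ext fun j => ?_)
      by_cases hj : j = i
      · subst hj
        have h1 := hsum β hβ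
        have h2 := hsum α hα
        rw [Finset.sum_congr rfl fun k hk => hall k (Finset.ne_of_mem_erase hk)] at h1
        exact Nat.add_left_cancel (h1.trans h2.symm)
      · exact hall j hj
    obtain ⟨j, hj, hne⟩ := this
    rw [monomialJet, Finset.prod_eq_zero (Finset.mem_univ j), mul_zero]
    rw [hγj j hj]
    rcases hne.lt_or_gt with h | h
    · simp [Nat.descFactorial_of_lt h]
    · simp [(Nat.sub_pos_of_lt h).ne', hj]

/-- The exponent vector of degree `d` with the given entries at `0`, `2` and `3`. -/
def expOfTriple (d : ℕ) (x : ℕ × ℕ × ℕ) : Fin 4 →₀ ℕ :=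
  Finsupp.equivFunOnFinite.symm ![x.1, d - (x.1 + x.2.1 + x.2.2), x.2.1, x.2.2]

theorem mem_expList {d m r : ℕ} {x : ℕ × ℕ × ℕ} :
    x ∈ expList d m r ↔ x.1 + x.2.1 + x.2.2 ≤ d ∧ d - (x.1 + x.2.1 + x.2.2) ≤ d - m ∧
      x.2.1 ≤ d - m ∧ x.2.2 ≤ d - m ∧ expWeight (expOfTriple d x) % 4 = r := by
  obtain ⟨a, b, c⟩ := x
  simp [expList, expWeight, expOfTriple]
  omega

theorem nodup_expList (d m r : ℕ) : (expList d m r).Nodup :=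
  (List.nodup_range.product (List.nodup_range.product List.nodup_range)).filter _

theorem mem_orderList {m : ℕ} {x : ℕ × ℕ × ℕ} :
    x ∈ orderList m ↔ x.1 + x.2.1 + x.2.2 < m := by
  obtain ⟨a, b, c⟩ := x
  simp [orderList]
  omega

theorem expOfTriple_mem {d : ℕ} {x : ℕ × ℕ × ℕ} (hx : x.1 + x.2.1 + x.2.2 ≤ d) :
    expOfTriple d x ∈ Finset.univ.finsuppAntidiag d := by
  rw [Finset.mem_finsuppAntidiag]
  refine ⟨?_, Finset.subset_univ _⟩
  simp [expOfTriple, Fin.sum_univ_four]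
  omega

theorem expOfTriple_eq {d : ℕ} {α : Fin 4 →₀ ℕ} (hα : α ∈ Finset.univ.finsuppAntidiag d) :
    expOfTriple d (α 0, α 2, α 3) = α := by
  have h : ∑ i, α i = d := (Finset.mem_finsuppAntidiag.1 hα).1
  rw [Fin.sum_univ_four] at h
  ext i
  fin_cases i <;> simp [expOfTriple]
  omega

theorem sum_map_expList {d m r : ℕ} {c : (Fin 4 →₀ ℕ) → ZMod 13}
    (hc : ∀ α ∈ Finset.univ.finsuppAntidiag d, ∀ i ≠ 0, d - m < α i → c α = 0)
    (E : ℕ × ℕ × ℕ → ZMod 13) :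
    ((expList d m r).map fun x => E x * c (expOfTriple d x)).sum =
      ∑ α ∈ Finset.univ.finsuppAntidiag d with expWeight α % 4 = r,
        c α * E (α 0, α 2, α 3) := by
  rw [← List.sum_toFinset _ (nodup_expList d m r)]
  refine Finset.sum_of_injOn (expOfTriple d) ?_ ?_ ?_ ?_
  · intro x _ y _ hxy
    have h : ∀ i, expOfTriple d x i = expOfTriple d y i := DFunLike.congr_fun hxy
    exact Prod.ext (h 0) (Prod.ext (h 2) (h 3))
  · intro x hx
    have hx := mem_expList.1 (List.mem_toFinset.1 hx)
    exact Finset.mem_filter.2 ⟨expOfTriple_mem hx.1, hx.2.2.2.2⟩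
  · intro α hα hne
    rw [Finset.mem_filter] at hα
    have hex : ∃ i : Fin 4, i ≠ 0 ∧ d - m < α i := by
      by_contra! hle
      refine hne ⟨(α 0, α 2, α 3), List.mem_toFinset.2 (mem_expList.2 ?_), expOfTriple_eq hα.1⟩
      rw [expOfTriple_eq hα.1]
      have h : ∑ i, α i = d := (Finset.mem_finsuppAntidiag.1 hα.1).1
      rw [Fin.sum_univ_four] at h
      have h1 := hle 1 (by decide)
      exact ⟨by dsimp only; omega, by dsimp only; omega, hle 2 (by decide), hle 3 (by decide), hα.2⟩
    obtain ⟨i, hi, hlt⟩ := hex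
    rw [hc α hα.1 i hi hlt, zero_mul]
  · intro x _
    exact mul_comm _ _

theorem eq_zero_of_specialPoints {d m : ℕ} (hm : m ≤ 13) (hmd : m ≤ d)
    (hrank : ∀ r < 4, hasFullRank d m r = true) (c : (Fin 4 →₀ ℕ) → ZMod 13)
    (h : ∀ j (γ b : Fin 4 → ℕ), ∑ i, γ i + ∑ i, b i < m →
      ∑ α ∈ Finset.univ.finsuppAntidiag d, c α * monomialJet (specialPoints j) γ b α = 0) :
    ∀ α ∈ Finset.univ.finsuppAntidiag d, c α = 0 := by
  have hc : ∀ α ∈ Finset.univ.finsuppAntidiag d, ∀ i ≠ 0, d - m < α i → c α = 0 := by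
    intro α hα i hi hlt
    have hj : ∃ j, specialPoints j = Pi.single i 1 := by
      fin_cases i
      · exact absurd rfl hi
      · exact ⟨0, rfl⟩
      · exact ⟨1, rfl⟩
      · exact ⟨2, rfl⟩
    obtain ⟨j, hj⟩ := hj
    exact eq_zero_of_coordinate hm (hj ▸ h j) hα (by omega)
  have horbit : ∀ v : Fin 4 → ZMod 13, (∀ g < 4, ∃ j, specialPoints j = rotate v g) →
      ∀ (k : ℕ) (b : Fin 4 → ℕ), k + ∑ i, b i < m → ∀ r < 4,
        ∑ α ∈ Finset.univ.finsuppAntidiag d with expWeight α % 4 = r,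
          c α * monomialJet v ![k, 0, 0, 0] b α = 0 := by
    intro v hv k b hb r hr
    refine sum_filter_expWeight_eq_zero (fun g hg => ?_) hr
    obtain ⟨j, hj⟩ := hv g hg
    simpa only [hj, monomialJet_rotate, mul_assoc] using
      h j ![k, 0, 0, 0] b (by simpa [Fin.sum_univ_four] using hb)
  intro α hα
  have hα' := expOfTriple_eq hα
  by_cases hle : ∀ i ≠ 0, α i ≤ d - m
  · have hr : expWeight α % 4 < 4 := Nat.mod_lt _ (by norm_num)
    have key := eq_zero_of_hasFullRank (hrank _ hr) (c := fun x => c (expOfTriple d x)) ?_ ?_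
      (α 0, α 2, α 3) ?_
    · rwa [hα'] at key
    · rintro ⟨k, y, z⟩ hb
      rw [mem_orderList] at hb
      rw [sum_map_expList hc fun x => (planeEntry (k, y, z) x : ZMod 13)]
      have := horbit ![0, 1, 1, 2] (by
        intro g hg
        interval_cases g
        exacts [⟨3, rfl⟩, ⟨4, rfl⟩, ⟨5, rfl⟩, ⟨6, rfl⟩]) k ![0, 0, y, z]
        (by simpa [Fin.sum_univ_four, add_assoc] using hb) _ hr
      simp only [monomialJet_plane, mul_left_comm (c _)] at this
      rw [← Finset.mul_sum] at this
      exact (mul_eq_zero.1 this).resolve_left (cast_factorial_ne_zero (by dsimp only at hb; omega))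
    · rintro ⟨x, y, z⟩ hb
      rw [mem_orderList] at hb
      rw [sum_map_expList hc fun t => (spaceEntry (x, y, z) t : ZMod 13)]
      have := horbit ![1, 1, 1, 1] (by
        intro g hg
        interval_cases g
        exacts [⟨7, rfl⟩, ⟨8, rfl⟩, ⟨9, rfl⟩, ⟨10, rfl⟩]) 0 ![x, 0, y, z]
        (by simpa [Fin.sum_univ_four, add_assoc] using hb) _ hr
      simpa only [monomialJet_space] using this
    · rw [mem_expList, hα']
      have h : ∑ i, α i = d := (Finset.mem_finsuppAntidiag.1 hα).1
      rw [Fin.sum_univ_four] at h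
      have h1 := hle 1 (by decide)
      exact ⟨by dsimp only; omega, by dsimp only; omega, hle 2 (by decide), hle 3 (by decide), rfl⟩
  · push Not at hle
    obtain ⟨i, hi, hlt⟩ := hle
    exact hc α hα i hi hlt

theorem exists_forall_fifteen :
    ∃ G : MvPolynomial (Fin 11 × Fin 4) ℤ, G ≠ 0 ∧ ∀ (K : Type) [Field K] (v : Fin 11 → Fin 4 → K),
      eval₂Hom (Int.castRingHom K) (fun q => v q.1 q.2) G ≠ 0 →
        ∀ f ∈ ⨅ j, pointIdeal K (v j) ^ 7, f.IsHomogeneous 15 → f = 0 := by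
  refine exists_forall_mem_iInf_pow_eq_zero 13 15 7 specialPoints
    (eq_zero_of_specialPoints (by norm_num) (by norm_num) fun r hr => ?_)
  interval_cases r
  exacts [hasFullRank_fifteen_zero, hasFullRank_fifteen_one, hasFullRank_fifteen_two,
    hasFullRank_fifteen_three]

theorem exists_forall_twentyOne :
    ∃ G : MvPolynomial (Fin 11 × Fin 4) ℤ, G ≠ 0 ∧ ∀ (K : Type) [Field K] (v : Fin 11 → Fin 4 → K),
      eval₂Hom (Int.castRingHom K) (fun q => v q.1 q.2) G ≠ 0 →
        ∀ f ∈ ⨅ j, pointIdeal K (v j) ^ 10, f.IsHomogeneous 21 → f = 0 := by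
  refine exists_forall_mem_iInf_pow_eq_zero 13 21 10 specialPoints
    (eq_zero_of_specialPoints (by norm_num) (by norm_num) fun r hr => ?_)
  interval_cases r
  exacts [hasFullRank_twentyOne_zero, hasFullRank_twentyOne_one, hasFullRank_twentyOne_two,
    hasFullRank_twentyOne_three]

/-! ### Initial degrees -/

section InitialDegree

variable {K : Type} [Field K]

theorem exists_linear_mem_pointIdeal (v : Fin 4 → K) :
    ∃ l ∈ pointIdeal K v, l ≠ 0 ∧ l.IsHomogeneous 1 := by
  by_cases h : v 0 = 0
  · exact ⟨X 0, Ideal.subset_span ⟨isHomogeneous_X K 0, by simpa using h⟩, X_ne_zero 0,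
      isHomogeneous_X K 0⟩
  · have hl : (C (v 1) * X 0 - C (v 0) * X 1 : MvPolynomial (Fin 4) K).IsHomogeneous 1 :=
      ((isHomogeneous_X K 0).C_mul _).sub ((isHomogeneous_X K 1).C_mul _)
    refine ⟨_, Ideal.subset_span ⟨hl, by simp [mul_comm]⟩, fun h0 => h ?_, hl⟩
    have := congrArg (eval (Pi.single 1 1)) h0
    simpa using this

theorem lt_alphaDeg {n d m : ℕ} (v : Fin n → Fin 4 → K)
    (h : ∀ f ∈ ⨅ j, pointIdeal K (v j) ^ m, f.IsHomogeneous d → f = 0) :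
    d < alphaDeg (⨅ j, pointIdeal K (v j) ^ m) := by
  choose l hl hl0 hl1 using fun j => exists_linear_mem_pointIdeal (v j)
  have hne : {t | ∃ f ∈ ⨅ j, pointIdeal K (v j) ^ m, f ≠ 0 ∧ f.IsHomogeneous t}.Nonempty := by
    refine ⟨_, ∏ j, l j ^ m, ?_, ?_,
      IsHomogeneous.prod _ _ (fun _ => 1 * m) fun j _ => (hl1 j).pow m⟩
    · refine Ideal.mem_iInf.2 fun j => ?_
      exact Ideal.mem_of_dvd _ (Finset.dvd_prod_of_mem _ (Finset.mem_univ j))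
        (Ideal.pow_mem_pow (hl j) m)
    · exact Finset.prod_ne_zero_iff.2 fun j _ => pow_ne_zero _ (hl0 j)
  by_contra! hle
  obtain ⟨f, hf, hf0, hfd⟩ : ∃ f ∈ ⨅ j, pointIdeal K (v j) ^ m, f ≠ 0 ∧
    f.IsHomogeneous (alphaDeg (⨅ j, pointIdeal K (v j) ^ m)) := Nat.sInf_mem hne
  have hX := hfd.mul
    (isHomogeneous_X_pow (R := K) 0 (d - alphaDeg (⨅ j, pointIdeal K (v j) ^ m)))
  rw [Nat.add_sub_cancel' hle] at hX
  exact mul_ne_zero hf0 (pow_ne_zero _ (X_ne_zero 0)) (h _ (Ideal.mul_mem_right _ _ hf) hX)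

end InitialDegree

/-- For 11 points in general position in `ℙ³`: `I^(7)` has no nonzero form of degree
15 and `I^(10)` has no nonzero form of degree 21; equivalently `α(I^(7)) ≥ 16` and
`α(I^(10)) ≥ 22`. -/
theorem eleven_points_alpha_bounds (K : Type) [Field K] [CharZero K] :
    ∃ G : MvPolynomial (Fin 11 × Fin 4) K, G ≠ 0 ∧
      ∀ v : Fin 11 → Fin 4 → K, (∀ j, v j ≠ 0) →
        eval (fun p => v p.1 p.2) G ≠ 0 →
        (∀ f ∈ ⨅ j, pointIdeal K (v j) ^ 7, f.IsHomogeneous 15 → f = 0) ∧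
        (∀ f ∈ ⨅ j, pointIdeal K (v j) ^ 10, f.IsHomogeneous 21 → f = 0) ∧
        16 ≤ alphaDeg (⨅ j, pointIdeal K (v j) ^ 7) ∧
        22 ≤ alphaDeg (⨅ j, pointIdeal K (v j) ^ 10) := by
  obtain ⟨G, hG, hGv⟩ := exists_forall_fifteen
  obtain ⟨H, hH, hHv⟩ := exists_forall_twentyOne
  have hinj := map_injective (σ := Fin 11 × Fin 4) (Int.castRingHom K) Int.cast_injective
  refine ⟨map (Int.castRingHom K) (G * H),
    (map_ne_zero_iff _ hinj).2 (mul_ne_zero hG hH), fun v _ hv => ?_⟩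
  rw [eval_map, ← coe_eval₂Hom, map_mul] at hv
  have h7 := hGv K v (left_ne_zero_of_mul hv)
  have h10 := hHv K v (right_ne_zero_of_mul hv)
  exact ⟨h7, h10, lt_alphaDeg v h7, lt_alphaDeg v h10⟩

end
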